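/- arXiv:1107.0563 — 2 statements merged into one kernel-verified Lean document; each statement's English description precedes it below -/
import Mathlib

section
/- Let K be a field, S = K[x_1,…,x_24], and I = (m_1, m_2, m_3, m_4, m_5) ⊆ S the squarefree monomial ideal with m_1 = x_1x_4x_7x_9x_10x_12x_15x_16x_18x_19x_20x_22x_23x_24, m_2 = x_2x_5x_8x_9x_11x_14x_15x_17x_18x_19x_21x_22x_23x_24, m_3 = x_3x_6x_7x_8x_11x_12x_13x_16x_17x_19x_20x_21x_23x_24, m_4 = x_4x_5x_10x_11x_12x_13x_14x_15x_20x_21x_22x_23, m_5 = x_6x_10x_13x_14x_16x_17x_18x_20x_21x_22x_24. Set g_1 = x_13·(m_4/x_13 + m_3), g_2 = m_1·m_2·(m_4/x_13 + m_3) + m_5, g_3 = m_1 + m_2 + m_3, where m_4/x_13 denotes the monomial obtained from m_4 by deleting the variable x_13. Then √((g_1, g_2, g_3)) = √I; in particular ara I ≤ 3. -/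
/-!
Statement 17: in `S = K[x_1,…,x_24]` (variables `x_k = X (k-1)` over
`Fin 24`), for the explicit squarefree monomial ideal `I = (m_1,…,m_5)`
below, the elements `g_1 = x_13 (m_4/x_13 + m_3)`,
`g_2 = m_1 m_2 (m_4/x_13 + m_3) + m_5`, `g_3 = m_1 + m_2 + m_3`
(where `m_4/x_13` is `m_4` with the variable `x_13` deleted) generate `I` up
to radical: `√(g_1,g_2,g_3) = √I`; in particular `ara I ≤ 3`.
-/

open MvPolynomial

universe u

/-- The arithmetical rank of an ideal. -/
noncomputable def ara {R : Type*} [CommRing R] (I : Ideal R) : ℕ :=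
  sInf {r : ℕ | ∃ a : Fin r → R, (Ideal.span (Set.range a)).radical = I.radical}

variable (K : Type u) [Field K]

/-- The squarefree monomial with support `A`. -/
noncomputable def mon (A : Finset (Fin 24)) : MvPolynomial (Fin 24) K :=
  ∏ v ∈ A, X v

/-- The support of `m_1`. -/
def A1 : Finset (Fin 24) := {0, 3, 6, 8, 9, 11, 14, 15, 17, 18, 19, 21, 22, 23}

/-- The support of `m_2`. -/
def A2 : Finset (Fin 24) := {1, 4, 7, 8, 10, 13, 14, 16, 17, 18, 20, 21, 22, 23}

/-- The support of `m_3`. -/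
def A3 : Finset (Fin 24) := {2, 5, 6, 7, 10, 11, 12, 15, 16, 18, 19, 20, 22, 23}

/-- The support of `m_4`. -/
def A4 : Finset (Fin 24) := {3, 4, 9, 10, 11, 12, 13, 14, 19, 20, 21, 22}

/-- The support of `m_5`. -/
def A5 : Finset (Fin 24) := {5, 9, 12, 13, 15, 16, 17, 19, 20, 21, 23}

noncomputable def m1 : MvPolynomial (Fin 24) K := mon K A1
noncomputable def m2 : MvPolynomial (Fin 24) K := mon K A2
noncomputable def m3 : MvPolynomial (Fin 24) K := mon K A3
noncomputable def m4 : MvPolynomial (Fin 24) K := mon K A4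
noncomputable def m5 : MvPolynomial (Fin 24) K := mon K A5

/-- `m_4 / x_13`: the monomial `m_4` with the variable `x_13 = X 12`
deleted. -/
noncomputable def m4div : MvPolynomial (Fin 24) K := mon K (A4.erase 12)

/-- `g_1 = x_13 (m_4/x_13 + m_3)`. -/
noncomputable def g1 : MvPolynomial (Fin 24) K := X 12 * (m4div K + m3 K)

/-- `g_2 = m_1 m_2 (m_4/x_13 + m_3) + m_5`. -/
noncomputable def g2 : MvPolynomial (Fin 24) K := m1 K * m2 K * (m4div K + m3 K) + m5 K

/-- `g_3 = m_1 + m_2 + m_3`. -/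
noncomputable def g3 : MvPolynomial (Fin 24) K := m1 K + m2 K + m3 K

variable {K} in
lemma mon_mem_iff {p : Ideal (MvPolynomial (Fin 24) K)} (hp : p.IsPrime)
    {A : Finset (Fin 24)} : mon K A ∈ p ↔ ∃ v ∈ A, X v ∈ p :=
  hp.prod_mem_iff

lemma mon_erase_mul_X {A : Finset (Fin 24)} {v : Fin 24} (hv : v ∈ A) :
    X v * mon K (A.erase v) = mon K A :=
  Finset.mul_prod_erase A _ hv

lemma g1_eq : g1 K = m4 K + X 12 * m3 K := by
  rw [g1, mul_add, m4div, mon_erase_mul_X K (by decide), m4]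

lemma span_g_le_span_m :
    Ideal.span {g1 K, g2 K, g3 K} ≤ Ideal.span {m1 K, m2 K, m3 K, m4 K, m5 K} := by
  set I := Ideal.span {m1 K, m2 K, m3 K, m4 K, m5 K} with hI
  have h1 : m1 K ∈ I := Ideal.subset_span (by simp)
  have h2 : m2 K ∈ I := Ideal.subset_span (by simp)
  have h3 : m3 K ∈ I := Ideal.subset_span (by simp)
  have h4 : m4 K ∈ I := Ideal.subset_span (by simp)
  have h5 : m5 K ∈ I := Ideal.subset_span (by simp)
  rw [Ideal.span_le]
  rintro x (rfl | rfl | rfl)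
  · rw [g1_eq]
    exact I.add_mem h4 (I.mul_mem_left _ h3)
  · exact I.add_mem (I.mul_mem_right _ (I.mul_mem_left _ h2)) h5
  · exact I.add_mem (I.add_mem h1 h2) h3

variable {K} in
/-- A prime containing `m_4 / x_13` contains `m_1` or `m_2`. -/
lemma m1_mem_or_m2_mem_of_m4div_mem {p : Ideal (MvPolynomial (Fin 24) K)} (hp : p.IsPrime)
    (h : m4div K ∈ p) : m1 K ∈ p ∨ m2 K ∈ p := by
  obtain ⟨v, hv, hvp⟩ := (mon_mem_iff hp).1 h
  have hcover : ∀ v ∈ A4.erase 12, v ∈ A1 ∨ v ∈ A2 := by decide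
  exact (hcover v hv).imp (fun hv => (mon_mem_iff hp).2 ⟨v, hv, hvp⟩)
    fun hv => (mon_mem_iff hp).2 ⟨v, hv, hvp⟩

variable {K} in
/-- A prime containing `m_5` contains `m_3`, or `m_4 / x_13`, or both `m_1` and `m_2`. -/
lemma mem_of_m5_mem {p : Ideal (MvPolynomial (Fin 24) K)} (hp : p.IsPrime)
    (h : m5 K ∈ p) : m3 K ∈ p ∨ m4div K ∈ p ∨ m1 K ∈ p ∧ m2 K ∈ p := by
  obtain ⟨v, hv, hvp⟩ := (mon_mem_iff hp).1 h
  have hcover : ∀ v ∈ A5, v ∈ A3 ∨ v ∈ A4.erase 12 ∨ v ∈ A1 ∧ v ∈ A2 := by decide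
  have hmem {A : Finset (Fin 24)} (hv : v ∈ A) : mon K A ∈ p := (mon_mem_iff hp).2 ⟨v, hv, hvp⟩
  exact (hcover v hv).imp hmem (Or.imp hmem (And.imp hmem hmem))

variable {K} in
lemma m_mem_of_g_mem {p : Ideal (MvPolynomial (Fin 24) K)} (hp : p.IsPrime)
    (hg1 : g1 K ∈ p) (hg2 : g2 K ∈ p) (hg3 : g3 K ∈ p) :
    m1 K ∈ p ∧ m2 K ∈ p ∧ m3 K ∈ p ∧ m4 K ∈ p ∧ m5 K ∈ p := by
  have h12 (h3 : m3 K ∈ p) (h : m1 K ∈ p ∨ m2 K ∈ p) : m1 K ∈ p ∧ m2 K ∈ p := by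
    have hadd : m1 K + m2 K ∈ p := (p.add_mem_iff_left h3).1 hg3
    rcases h with h | h
    · exact ⟨h, (p.add_mem_iff_right h).1 hadd⟩
    · exact ⟨(p.add_mem_iff_left h).1 hadd, h⟩
  have h4 (h3 : m3 K ∈ p) : m4 K ∈ p :=
    (p.add_mem_iff_left (p.mul_mem_left (X 12) h3)).1 (g1_eq K ▸ hg1)
  suffices h : m3 K ∈ p ∧ m5 K ∈ p ∧ (m1 K ∈ p ∨ m2 K ∈ p) by
    obtain ⟨h3, h5, h⟩ := h
    exact ⟨(h12 h3 h).1, (h12 h3 h).2, h3, h4 h3, h5⟩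
  rcases hp.mem_or_mem hg1 with hX | hsum
  · have h3 : m3 K ∈ p := (mon_mem_iff hp).2 ⟨12, by decide, hX⟩
    have h5 : m5 K ∈ p := (mon_mem_iff hp).2 ⟨12, by decide, hX⟩
    refine ⟨h3, h5, ?_⟩
    rcases hp.mem_or_mem ((p.add_mem_iff_left h5).1 hg2) with h | h
    · exact hp.mem_or_mem h
    · exact m1_mem_or_m2_mem_of_m4div_mem hp ((p.add_mem_iff_left h3).1 h)
  · have h5 : m5 K ∈ p := (p.add_mem_iff_right (p.mul_mem_left _ hsum)).1 hg2
    rcases mem_of_m5_mem hp h5 with h3 | h4 | ⟨h1, h2⟩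
    · exact ⟨h3, h5, m1_mem_or_m2_mem_of_m4div_mem hp ((p.add_mem_iff_left h3).1 hsum)⟩
    · exact ⟨(p.add_mem_iff_right h4).1 hsum, h5, m1_mem_or_m2_mem_of_m4div_mem hp h4⟩
    · exact ⟨(p.add_mem_iff_right (p.add_mem h1 h2)).1 hg3, h5, Or.inl h1⟩

lemma radical_span_g_eq_radical_span_m :
    (Ideal.span {g1 K, g2 K, g3 K}).radical
      = (Ideal.span {m1 K, m2 K, m3 K, m4 K, m5 K}).radical := by
  refine le_antisymm (Ideal.radical_mono (span_g_le_span_m K)) ?_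
  rw [Ideal.radical_le_radical_iff, Ideal.radical_eq_sInf]
  refine le_sInf fun p ⟨hgp, hp⟩ => ?_
  simp only [Ideal.span_le, Set.insert_subset_iff, Set.singleton_subset_iff, SetLike.mem_coe]
  exact m_mem_of_g_mem hp (hgp (Ideal.subset_span (by simp)))
    (hgp (Ideal.subset_span (by simp))) (hgp (Ideal.subset_span (by simp)))

lemma ara_le_of_radical_eq {R : Type*} [CommRing R] {I : Ideal R} {r : ℕ} (a : Fin r → R)
    (h : (Ideal.span (Set.range a)).radical = I.radical) : ara I ≤ r :=
  Nat.sInf_le ⟨a, h⟩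

theorem radical_eq_of_J2_case :
    (Ideal.span {g1 K, g2 K, g3 K}).radical
      = (Ideal.span {m1 K, m2 K, m3 K, m4 K, m5 K}).radical ∧
    ara (Ideal.span {m1 K, m2 K, m3 K, m4 K, m5 K} :
      Ideal (MvPolynomial (Fin 24) K)) ≤ 3 := by
  refine ⟨radical_span_g_eq_radical_span_m K, ara_le_of_radical_eq ![g1 K, g2 K, g3 K] ?_⟩
  rw [← radical_span_g_eq_radical_span_m]
  simp only [Matrix.range_cons, Matrix.range_empty, Set.union_empty, Set.singleton_union]
end

section
/- Let K be a field, and let {x_{s,t} : 1 ≤ s ≤ 6, 1 ≤ t ≤ i_s} ∪ {y_{u,v} : u ∈ {2,3,4}, 1 ≤ v ≤ j_u} be pairwise distinct variables of a polynomial ring S over K, with i_1,…,i_6 ≥ 1 and j_2, j_3, j_4 ≥ 1. Let P_1 = (x_{1,1},…,x_{1,i_1}, x_{4,1},…,x_{4,i_4}, x_{5,1},…,x_{5,i_5}), P_2 = (x_{1,1},…,x_{1,i_1}, x_{2,1},…,x_{2,i_2}, x_{6,1},…,x_{6,i_6}, y_{2,1},…,y_{2,j_2}), P_3 = (x_{2,1},…,x_{2,i_2},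 x_{3,1},…,x_{3,i_3}, x_{5,1},…,x_{5,i_5}, y_{3,1},…,y_{3,j_3}), P_4 = (x_{3,1},…,x_{3,i_3}, x_{4,1},…,x_{4,i_4}, x_{6,1},…,x_{6,i_6}, y_{4,1},…,y_{4,j_4}), and I = P_1 ∩ P_2 ∩ P_3 ∩ P_4. Set N = i_1 + ⋯ + i_6 + j_2 + j_3 + j_4. Then pd_S S/I = max{N − j_2 − 2, N − j_3 − 2, N − j_4 − 2}. -/
/-!
Statement 19 (Lemma `claim:reg4gen`, case `H₁₇`): let the variables of the
polynomial ring `S` be `x_{s,t}` (`1 ≤ s ≤ 6`, `1 ≤ t ≤ i_s`) and `y_{u,v}`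
(`u ∈ {2,3,4}`, `1 ≤ v ≤ j_u`), all distinct, with all `i_s ≥ 1`, `j_u ≥ 1`.
With the prime ideals `P₁ = (x₁,x₄,x₅-blocks)`, `P₂ = (x₁,x₂,x₆,y₂-blocks)`,
`P₃ = (x₂,x₃,x₅,y₃-blocks)`, `P₄ = (x₃,x₄,x₆,y₄-blocks)` and
`I = P₁ ∩ P₂ ∩ P₃ ∩ P₄`, setting `N = i₁ + ⋯ + i₆ + j₂ + j₃ + j₄`, one has
`pd_S S/I = max {N − j₂ − 2, N − j₃ − 2, N − j₄ − 2}`.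

The `x`-blocks are indexed by `Fin 6` (so `x_s ↦ s-1`) and the `y`-blocks by
`Fin 3` (so `y₂ ↦ 0`, `y₃ ↦ 1`, `y₄ ↦ 2`).
-/

open CategoryTheory MvPolynomial

universe u

/-- The projective dimension (possibly `⊤`) of a module `M` over a commutative
ring `R`, via the standard characterization by vanishing of `Ext` groups. -/
noncomputable def pdim (R : Type u) [CommRing R] (M : ModuleCat.{u} R) : ℕ∞ :=
  sInf {n : ℕ∞ | ∀ k : ℕ, n < (k : ℕ∞) → ∀ N : ModuleCat.{u} R,
    Subsingleton (((Ext R (ModuleCat.{u} R) k).obj (Opposite.op M)).obj N)}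

/-- The index type of the variables: `x`-variables in six blocks of sizes
`i 0, …, i 5`, and `y`-variables in three blocks of sizes `j 0, j 1, j 2`. -/
abbrev VarIdx (i : Fin 6 → ℕ) (j : Fin 3 → ℕ) : Type :=
  (Σ s : Fin 6, Fin (i s)) ⊕ (Σ t : Fin 3, Fin (j t))

/-- The monomial prime ideal generated by the variables in the `x`-blocks
`xs` and the `y`-blocks `ys`. -/
noncomputable def blockPrime (K : Type u) [Field K] (i : Fin 6 → ℕ) (j : Fin 3 → ℕ)
    (xs : Set (Fin 6)) (ys : Set (Fin 3)) : Ideal (MvPolynomial (VarIdx i j) K) :=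
  Ideal.span (MvPolynomial.X ''
    {v : VarIdx i j | Sum.elim (fun p => p.1 ∈ xs) (fun p => p.1 ∈ ys) v})

section ExtVanishing

namespace CategoryTheory.ShortComplex.ShortExact

variable {C : Type*} [Category* C] [Abelian C] [HasExt C] {S : ShortComplex C}
  {Y : C} {k : ℕ}

lemma subsingleton_ext_X₁ (hS : S.ShortExact) (h₂ : Subsingleton (Abelian.Ext S.X₂ Y k))
    (h₃ : Subsingleton (Abelian.Ext S.X₃ Y (k + 1))) :
    Subsingleton (Abelian.Ext S.X₁ Y k) := by
  refine subsingleton_of_forall_eq 0 fun e ↦ ?_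
  obtain ⟨x, rfl⟩ := Abelian.Ext.contravariant_sequence_exact₁ hS _ e (add_comm 1 k)
    (Subsingleton.elim _ _)
  rw [Subsingleton.elim x 0, Abelian.Ext.comp_zero]

lemma subsingleton_ext_X₂ (hS : S.ShortExact) (h₁ : Subsingleton (Abelian.Ext S.X₁ Y k))
    (h₃ : Subsingleton (Abelian.Ext S.X₃ Y k)) :
    Subsingleton (Abelian.Ext S.X₂ Y k) := by
  refine subsingleton_of_forall_eq 0 fun e ↦ ?_
  obtain ⟨x, rfl⟩ := Abelian.Ext.contravariant_sequence_exact₂ hS _ e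
    (Subsingleton.elim _ _)
  rw [Subsingleton.elim x 0, Abelian.Ext.comp_zero]

lemma subsingleton_ext_X₃ (hS : S.ShortExact) (h₁ : Subsingleton (Abelian.Ext S.X₁ Y k))
    (h₂ : Subsingleton (Abelian.Ext S.X₂ Y (k + 1))) :
    Subsingleton (Abelian.Ext S.X₃ Y (k + 1)) := by
  refine subsingleton_of_forall_eq 0 fun e ↦ ?_
  obtain ⟨x, rfl⟩ := Abelian.Ext.contravariant_sequence_exact₃ hS _ e
    (Subsingleton.elim _ _) (add_comm 1 k)
  rw [Subsingleton.elim x 0, Abelian.Ext.comp_zero]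

end CategoryTheory.ShortComplex.ShortExact

lemma CategoryTheory.Retract.subsingleton_ext {C : Type*} [Category* C] [Abelian C] [HasExt C]
    {X X' Y : C} (r : Retract X X') {k : ℕ} (h : Subsingleton (Abelian.Ext X' Y k)) :
    Subsingleton (Abelian.Ext X Y k) := by
  refine subsingleton_of_forall_eq 0 fun e ↦ ?_
  rw [← e.mk₀_id_comp, ← r.retract, ← Abelian.Ext.mk₀_comp_mk₀,
    Abelian.Ext.comp_assoc_of_second_deg_zero,
    Subsingleton.elim ((Abelian.Ext.mk₀ r.r).comp e (zero_add _)) 0, Abelian.Ext.comp_zero]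

/-- The derived functor `Ext` vanishes if and only if the `Ext` group of the derived category
does. -/
lemma subsingleton_ext_iff {R : Type u} [CommRing R] (M Y : ModuleCat.{u} R) (k : ℕ) :
    Subsingleton (((Ext R (ModuleCat.{u} R) (k + 1)).obj (Opposite.op M)).obj Y) ↔
      Subsingleton (Abelian.Ext M Y (k + 1)) := by
  let P := projectiveResolution M
  rw [← ModuleCat.isZero_iff_subsingleton, (P.isoExt (R := R) (k + 1) Y).isZero_iff,
    ← HomologicalComplex.exactAt_iff_isZero_homology,
    HomologicalComplex.exactAt_iff' _ k (k + 1) (k + 2) (by simp) (by simp),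
    ShortComplex.moduleCat_exact_iff]
  constructor
  · intro h
    refine subsingleton_of_forall_eq 0 fun e ↦ ?_
    obtain ⟨f, hf, rfl⟩ := P.extMk_surjective e (k + 2) rfl
    rw [P.extMk_eq_zero_iff f (k + 2) rfl hf k rfl]
    exact h f hf
  · intro h f hf
    exact (P.extMk_eq_zero_iff f (k + 2) rfl hf k rfl).1 (Subsingleton.elim _ _)

end ExtVanishing

section CyclicModules

variable {R : Type u} [CommRing R]

/-- Vanishing of `Ext^k(R/I, Y)`. -/
def ExtVanishes (I : Ideal R) (Y : ModuleCat.{u} R) (k : ℕ) : Prop :=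
  Subsingleton (Abelian.Ext (ModuleCat.of R (R ⧸ I)) Y k)

/-- The complex `R/(I ∩ J) → R/I × R/J → R/(I + J)`. -/
noncomputable abbrev infSupComplex (I J : Ideal R) : ShortComplex (ModuleCat.{u} R) :=
  ModuleCat.shortComplexOfCompEqZero
    ((Submodule.factor (inf_le_left : I ⊓ J ≤ I)).prod
      (Submodule.factor (inf_le_right : I ⊓ J ≤ J)))
    ((Submodule.factor (le_sup_left : I ≤ I ⊔ J)).coprod
      (-(Submodule.factor (le_sup_right : J ≤ I ⊔ J))))
    (by
      ext
      simp)

lemma infSupComplex_shortExact (I J : Ideal R) : (infSupComplex I J).ShortExact := by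
  apply ModuleCat.shortComplex_shortExact
  · rintro ⟨a, b⟩
    obtain ⟨a, rfl⟩ := Submodule.Quotient.mk_surjective _ a
    obtain ⟨b, rfl⟩ := Submodule.Quotient.mk_surjective _ b
    constructor
    · intro h
      have h' : a - b ∈ I ⊔ J := by
        rw [← Submodule.Quotient.mk_eq_zero]
        simpa [sub_eq_add_neg] using h
      obtain ⟨x, hx, y, hy, hxy⟩ := Submodule.mem_sup.1 h'
      refine ⟨Submodule.Quotient.mk (a - x), Prod.ext ?_ ?_⟩
      · exact (Submodule.Quotient.eq I).2 (by simpa using hx)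
      · have hb : a - x - b = y := by linear_combination -hxy
        exact (Submodule.Quotient.eq J).2 (hb ▸ hy)
    · rintro ⟨c, hc⟩
      obtain ⟨c, rfl⟩ := Submodule.Quotient.mk_surjective _ c
      rw [← hc]
      simp
  · rw [injective_iff_map_eq_zero]
    intro c hc
    obtain ⟨c, rfl⟩ := Submodule.Quotient.mk_surjective _ c
    have h₁ : (Submodule.Quotient.mk c : R ⧸ I) = 0 := congrArg Prod.fst hc
    have h₂ : (Submodule.Quotient.mk c : R ⧸ J) = 0 := congrArg Prod.snd hc
    rw [Submodule.Quotient.mk_eq_zero] at h₁ h₂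
    exact (Submodule.Quotient.mk_eq_zero _).2 ⟨h₁, h₂⟩
  · intro c
    obtain ⟨c, rfl⟩ := Submodule.Quotient.mk_surjective _ c
    exact ⟨(Submodule.Quotient.mk c, 0), by simp⟩

namespace ExtVanishes

variable {I J : Ideal R} {Y : ModuleCat.{u} R} {k : ℕ}

lemma prod (hI : ExtVanishes I Y k) (hJ : ExtVanishes J Y k) :
    Subsingleton (Abelian.Ext (ModuleCat.of R ((R ⧸ I) × (R ⧸ J))) Y k) := by
  have hS : (ModuleCat.shortComplexOfCompEqZero (LinearMap.inl R (R ⧸ I) (R ⧸ J))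
      (LinearMap.snd R (R ⧸ I) (R ⧸ J)) (by ext; simp)).ShortExact :=
    ModuleCat.shortComplex_shortExact _ Function.Exact.inl_snd LinearMap.inl_injective
      LinearMap.snd_surjective
  exact hS.subsingleton_ext_X₂ hI hJ

lemma inf (hI : ExtVanishes I Y k) (hJ : ExtVanishes J Y k)
    (h : ExtVanishes (I ⊔ J) Y (k + 1)) : ExtVanishes (I ⊓ J) Y k :=
  (infSupComplex_shortExact I J).subsingleton_ext_X₁ (hI.prod hJ) h

lemma sup (h : ExtVanishes (I ⊓ J) Y k) (hI : ExtVanishes I Y (k + 1))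
    (hJ : ExtVanishes J Y (k + 1)) : ExtVanishes (I ⊔ J) Y (k + 1) :=
  (infSupComplex_shortExact I J).subsingleton_ext_X₃ h (hI.prod hJ)

lemma left (h : ExtVanishes (I ⊓ J) Y k) (h' : ExtVanishes (I ⊔ J) Y k) :
    ExtVanishes I Y k :=
  Retract.subsingleton_ext
    ⟨ModuleCat.ofHom (LinearMap.inl R (R ⧸ I) (R ⧸ J)),
      ModuleCat.ofHom (LinearMap.fst R (R ⧸ I) (R ⧸ J)), by ext; simp⟩
    ((infSupComplex_shortExact I J).subsingleton_ext_X₂ h h')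

lemma of_smul_eq {r : R} (hr : r ∈ I) (hY : ∀ y : Y, r • y = y) : ExtVanishes I Y k := by
  refine subsingleton_of_forall_eq 0 fun e ↦ ?_
  have h₁ : r • 𝟙 Y = 𝟙 Y := by ext y; simpa using hY y
  have h₂ : r • 𝟙 (ModuleCat.of R (R ⧸ I)) = 0 := by
    ext
    exact (Submodule.Quotient.mk_eq_zero I).2 (by simpa using hr)
  have h₃ : r • e = e := by rw [Abelian.Ext.smul_eq_comp_mk₀, h₁, Abelian.Ext.comp_mk₀_id]
  rw [← h₃, ← e.mk₀_id_comp, ← Abelian.Ext.smul_comp, ← Abelian.Ext.mk₀_smul, h₂,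
    Abelian.Ext.mk₀_zero, Abelian.Ext.zero_comp]

end ExtVanishes

/-- The complex `R/I → R/I → R/J` given by multiplication by `r` and the projection, for
`J = I + (r)`. -/
noncomputable abbrev mulFactorComplex {I J : Ideal R} {r : R} (h : J = I ⊔ Ideal.span {r}) :
    ShortComplex (ModuleCat.{u} R) :=
  ModuleCat.shortComplexOfCompEqZero (LinearMap.lsmul R (R ⧸ I) r)
    (Submodule.factor (h ▸ le_sup_left : I ≤ J)) (by
      ext
      exact (Submodule.Quotient.mk_eq_zero J).2
        (h ▸ Ideal.mem_sup_right (by simp)))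

lemma mulFactorComplex_shortExact {I J : Ideal R} {r : R} (h : J = I ⊔ Ideal.span {r})
    (hr : ∀ a, r * a ∈ I → a ∈ I) : (mulFactorComplex h).ShortExact := by
  apply ModuleCat.shortComplex_shortExact
  · intro a
    obtain ⟨a, rfl⟩ := Submodule.Quotient.mk_surjective _ a
    constructor
    · intro ha
      have ha' : a ∈ I ⊔ Ideal.span {r} := by
        rw [← h, ← Submodule.Quotient.mk_eq_zero]
        simpa using ha
      obtain ⟨x, hx, y, hy, rfl⟩ := Submodule.mem_sup.1 ha'
      obtain ⟨b, rfl⟩ := Ideal.mem_span_singleton'.1 hy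
      exact ⟨Submodule.Quotient.mk b, (Submodule.Quotient.eq I).2
        (by simpa [mul_comm] using I.neg_mem hx)⟩
    · rintro ⟨b, hb⟩
      rw [← hb]
      exact LinearMap.congr_fun (ModuleCat.hom_ext_iff.1 (mulFactorComplex h).zero) b
  · rw [injective_iff_map_eq_zero]
    intro a ha
    obtain ⟨a, rfl⟩ := Submodule.Quotient.mk_surjective _ a
    exact (Submodule.Quotient.mk_eq_zero _).2 (hr a ((Submodule.Quotient.mk_eq_zero _).1 ha))
  · exact Submodule.factor_surjective (h ▸ le_sup_left)

namespace ExtVanishes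

variable {I J : Ideal R} {r : R} {Y : ModuleCat.{u} R} {k : ℕ}

lemma of_eq_sup_span (h : J = I ⊔ Ideal.span {r}) (hr : ∀ a, r * a ∈ I → a ∈ I)
    (h₀ : ExtVanishes I Y k) (h₁ : ExtVanishes I Y (k + 1)) : ExtVanishes J Y (k + 1) :=
  (mulFactorComplex_shortExact h hr).subsingleton_ext_X₃ h₀ h₁

lemma of_sup_span_of_smul_eq_zero (h : J = I ⊔ Ideal.span {r}) (hr : ∀ a, r * a ∈ I → a ∈ I)
    (hY : ∀ y : Y, r • y = 0) (h₁ : ExtVanishes J Y (k + 1)) : ExtVanishes I Y k := by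
  refine subsingleton_of_forall_eq 0 fun e ↦ ?_
  have : Subsingleton (Abelian.Ext (mulFactorComplex h).X₃ Y (k + 1)) := h₁
  obtain ⟨x, rfl⟩ := Abelian.Ext.contravariant_sequence_exact₁ (mulFactorComplex_shortExact h hr)
    _ e (add_comm 1 k) (Subsingleton.elim _ _)
  have hf : (mulFactorComplex h).f = r • 𝟙 (ModuleCat.of R (R ⧸ I)) := rfl
  have h₀ : r • 𝟙 Y = 0 := by ext y; exact hY y
  rw [hf, Abelian.Ext.mk₀_smul, Abelian.Ext.smul_comp, Abelian.Ext.mk₀_id_comp,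
    Abelian.Ext.smul_eq_comp_mk₀, h₀, Abelian.Ext.mk₀_zero, Abelian.Ext.comp_zero]

end ExtVanishes

end CyclicModules

section MonomialIdeals

variable {σ : Type*} {R : Type*} [CommRing R]

/-- An ideal of polynomials is monomial if it contains all the monomials occurring in its
elements. -/
def IsMonomialIdeal (I : Ideal (MvPolynomial σ R)) : Prop :=
  ∀ f ∈ I, ∀ m ∈ f.support, monomial m (1 : R) ∈ I

lemma MvPolynomial.mem_of_forall_monomial_mem {I : Ideal (MvPolynomial σ R)}
    {f : MvPolynomial σ R} (h : ∀ m ∈ f.support, monomial m (1 : R) ∈ I) : f ∈ I := by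
  rw [f.as_sum]
  refine I.sum_mem fun m hm ↦ ?_
  rw [← mul_one (coeff m f), ← C_mul_monomial]
  exact I.mul_mem_left _ (h m hm)

namespace IsMonomialIdeal

variable {I J L : Ideal (MvPolynomial σ R)}

lemma inf (hI : IsMonomialIdeal I) (hJ : IsMonomialIdeal J) : IsMonomialIdeal (I ⊓ J) :=
  fun f hf m hm ↦ ⟨hI f hf.1 m hm, hJ f hf.2 m hm⟩

lemma mem_or_mem (hI : IsMonomialIdeal I) (hJ : IsMonomialIdeal J) {f : MvPolynomial σ R}
    (hf : f ∈ I ⊔ J) {m : σ →₀ ℕ} (hm : m ∈ f.support) :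
    monomial m (1 : R) ∈ I ∨ monomial m (1 : R) ∈ J := by
  classical
  obtain ⟨a, ha, b, hb, rfl⟩ := Submodule.mem_sup.1 hf
  exact (Finset.mem_union.1 (support_add hm)).imp (hI a ha m) (hJ b hb m)

/-- Monomial ideals form a distributive lattice. -/
lemma inf_sup_eq (hI : IsMonomialIdeal I) (hJ : IsMonomialIdeal J) (hL : IsMonomialIdeal L) :
    I ⊓ J ⊔ L = (I ⊔ L) ⊓ (J ⊔ L) := by
  refine le_antisymm (le_inf (sup_le_sup_right inf_le_left L) (sup_le_sup_right inf_le_right L))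
    fun f hf ↦ mem_of_forall_monomial_mem fun m hm ↦ ?_
  rcases hI.mem_or_mem hL hf.1 hm with h₁ | h₁
  · rcases hJ.mem_or_mem hL hf.2 hm with h₂ | h₂
    · exact Ideal.mem_sup_left ⟨h₁, h₂⟩
    · exact Ideal.mem_sup_right h₂
  · exact Ideal.mem_sup_right h₁

end IsMonomialIdeal

variable (R) in
/-- The ideal generated by the variables in `A`. -/
noncomputable def varIdeal (A : Set σ) : Ideal (MvPolynomial σ R) :=
  Ideal.span (X '' A)

lemma mem_varIdeal {A : Set σ} {f : MvPolynomial σ R} :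
    f ∈ varIdeal R A ↔ ∀ m ∈ f.support, ∃ i ∈ A, m i ≠ 0 :=
  mem_ideal_span_X_image

lemma X_mem_varIdeal {A : Set σ} {v : σ} (hv : v ∈ A) : X v ∈ varIdeal R A :=
  Ideal.subset_span (Set.mem_image_of_mem X hv)

lemma varIdeal_union (A B : Set σ) : varIdeal R (A ∪ B) = varIdeal R A ⊔ varIdeal R B := by
  rw [varIdeal, Set.image_union, Ideal.span_union]; rfl

lemma varIdeal_mono {A B : Set σ} (h : A ⊆ B) : varIdeal R A ≤ varIdeal R B :=
  Ideal.span_mono (Set.image_mono h)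

lemma varIdeal_empty : varIdeal R (∅ : Set σ) = ⊥ := by
  simp [varIdeal]

lemma varIdeal_insert (a : σ) (A : Set σ) :
    varIdeal R (insert a A) = varIdeal R A ⊔ Ideal.span {X a} := by
  rw [Set.insert_eq, Set.union_comm, varIdeal_union]
  simp [varIdeal]

lemma isMonomialIdeal_varIdeal (A : Set σ) : IsMonomialIdeal (varIdeal R A) := by
  intro f hf m hm
  obtain ⟨i, hi, hmi⟩ := mem_varIdeal.1 hf m hm
  refine mem_varIdeal.2 fun n hn ↦ ?_
  rw [Finset.mem_singleton.1 (support_monomial_subset hn)]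
  exact ⟨i, hi, hmi⟩

lemma mem_varIdeal_of_X_mul_mem {A : Set σ} {a : σ} (ha : a ∉ A) (f : MvPolynomial σ R)
    (h : X a * f ∈ varIdeal R A) : f ∈ varIdeal R A := by
  refine mem_varIdeal.2 fun m hm ↦ ?_
  obtain ⟨i, hi, hmi⟩ := mem_varIdeal.1 h (Finsupp.single a 1 + m) (by
    rw [mem_support_iff, coeff_X_mul]; exact mem_support_iff.1 hm)
  have hai : a ≠ i := fun h ↦ ha (h ▸ hi)
  exact ⟨i, hi, by simpa [hai] using hmi⟩

lemma varIdeal_inf_sup (A B C : Set σ) :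
    varIdeal R A ⊓ varIdeal R B ⊔ varIdeal R C = varIdeal R (A ∪ C) ⊓ varIdeal R (B ∪ C) := by
  simp only [varIdeal_union]
  exact (isMonomialIdeal_varIdeal A).inf_sup_eq (isMonomialIdeal_varIdeal B)
    (isMonomialIdeal_varIdeal C)

lemma varIdeal_inf_inf_sup (A B C D : Set σ) :
    varIdeal R A ⊓ varIdeal R B ⊓ varIdeal R C ⊔ varIdeal R D =
      varIdeal R (A ∪ D) ⊓ varIdeal R (B ∪ D) ⊓ varIdeal R (C ∪ D) := by
  rw [((isMonomialIdeal_varIdeal A).inf (isMonomialIdeal_varIdeal B)).inf_sup_eq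
    (isMonomialIdeal_varIdeal C) (isMonomialIdeal_varIdeal D), varIdeal_inf_sup, ← varIdeal_union]

end MonomialIdeals

section VariableIdeals

variable {K : Type u} [Field K] {σ : Type}

lemma exists_ne_top_varIdeal_le {A : Set σ} {d : σ} (hd : d ∉ A) :
    ∃ Q : Ideal (MvPolynomial σ K), Q ≠ ⊤ ∧ varIdeal K A ≤ Q ∧ X d - 1 ∈ Q := by
  classical
  let φ : MvPolynomial σ K →+* K := eval fun v ↦ if v ∈ A then 0 else 1
  refine ⟨RingHom.ker φ, RingHom.ker_ne_top φ, ?_, by simp [φ, hd, RingHom.mem_ker]⟩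
  rw [varIdeal, Ideal.span_le]
  rintro _ ⟨v, hv, rfl⟩
  simp [φ, hv, RingHom.mem_ker]

variable [Finite σ]

lemma extVanishes_varIdeal (Y : ModuleCat.{u} (MvPolynomial σ K)) (A : Set σ) {k : ℕ}
    (hk : A.ncard < k) : ExtVanishes (varIdeal K A) Y k := by
  induction A, A.toFinite using Set.Finite.induction_on generalizing k with
  | empty =>
    obtain ⟨k, rfl⟩ := Nat.exists_eq_succ_of_ne_zero (by lia : k ≠ 0)
    have : Projective (ModuleCat.of (MvPolynomial σ K)
        (MvPolynomial σ K ⧸ varIdeal K (∅ : Set σ))) :=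
      Projective.of_iso (Submodule.quotEquivOfEqBot _ varIdeal_empty).symm.toModuleIso
        ((ModuleCat.of _ (MvPolynomial σ K)).projective_of_free (Module.Basis.singleton Unit _))
    exact Abelian.Ext.subsingleton_of_projective _ _ k
  | @insert a A ha hA ih =>
    obtain ⟨k, rfl⟩ := Nat.exists_eq_succ_of_ne_zero (by lia : k ≠ 0)
    rw [Set.ncard_insert_of_notMem ha hA] at hk
    exact ExtVanishes.of_eq_sup_span (varIdeal_insert a A) (mem_varIdeal_of_X_mul_mem ha)
      (ih (by lia)) (ih (by lia))

lemma not_extVanishes_varIdeal {Q : Ideal (MvPolynomial σ K)} (hQ : Q ≠ ⊤) (A : Set σ)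
    (hA : varIdeal K A ≤ Q) :
    ¬ ExtVanishes (varIdeal K A) (ModuleCat.of _ (MvPolynomial σ K ⧸ Q)) A.ncard := by
  induction A, A.toFinite using Set.Finite.induction_on with
  | empty =>
    intro h
    rw [Set.ncard_empty] at h
    have h' := Abelian.Ext.homEquiv₀.subsingleton_congr.1 h
    have h₀ := Subsingleton.elim (ModuleCat.ofHom (Submodule.factor hA)) 0
    have h₁ := LinearMap.congr_fun (ModuleCat.hom_ext_iff.1 h₀) (Submodule.Quotient.mk 1)
    exact hQ (Q.eq_top_iff_one.2 ((Submodule.Quotient.mk_eq_zero Q).1 h₁))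
  | @insert a A ha hfin ih =>
    intro h
    rw [Set.ncard_insert_of_notMem ha hfin] at h
    refine ih ((varIdeal_mono (Set.subset_insert a A)).trans hA)
      (h.of_sup_span_of_smul_eq_zero (varIdeal_insert a A) (mem_varIdeal_of_X_mul_mem ha) ?_)
    intro y
    obtain ⟨y, rfl⟩ := Submodule.Quotient.mk_surjective _ y
    exact (Submodule.Quotient.mk_eq_zero Q).2
      (Q.mul_mem_right y (hA (X_mem_varIdeal (Set.mem_insert a A))))

lemma Set.ncard_lt_ncard_of_mem {A B : Set σ} (h : A ⊆ B) {x : σ} (hB : x ∈ B) (hA : x ∉ A) :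
    A.ncard < B.ncard :=
  Set.ncard_lt_ncard ⟨h, fun h' ↦ hA (h' hB)⟩ B.toFinite

variable {A B C D : Set σ}

lemma extVanishes_varIdeal_inf (Y : ModuleCat.{u} (MvPolynomial σ K)) {k : ℕ}
    (hA : A.ncard < k) (hB : B.ncard < k) (hAB : (A ∪ B).ncard < k + 1) :
    ExtVanishes (varIdeal K A ⊓ varIdeal K B) Y k :=
  .inf (extVanishes_varIdeal Y A hA) (extVanishes_varIdeal Y B hB)
    (varIdeal_union (R := K) A B ▸ extVanishes_varIdeal Y _ hAB)

/-- If `d ∈ D` lies in none of `A`, `B`, `C`, and none of these three sets is contained in the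
union of the other two, then `pd S/(P_A ∩ P_B ∩ P_C ∩ P_D) ≥ |A ∪ B ∪ C| - 2`, where `P_Z` is the
ideal generated by the variables in `Z`. -/
lemma exists_not_extVanishes_varIdeal_inf {a b c d : σ} (ha : a ∈ A \ (B ∪ C))
    (hb : b ∈ B \ (A ∪ C)) (hc : c ∈ C \ (A ∪ B)) (hd : d ∈ D \ (A ∪ B ∪ C)) {k : ℕ}
    (hk : (A ∪ B ∪ C).ncard = k + 2) :
    ∃ Y, ¬ ExtVanishes (varIdeal K A ⊓ varIdeal K B ⊓ varIdeal K C ⊓ varIdeal K D) Y k := by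
  obtain ⟨Q, hQ, hABC, hdQ⟩ := exists_ne_top_varIdeal_le (K := K) hd.2
  refine ⟨ModuleCat.of _ (_ ⧸ Q), fun h ↦ ?_⟩
  have hdY : ∀ y : MvPolynomial σ K ⧸ Q, (X d : MvPolynomial σ K) • y = y := by
    intro y
    obtain ⟨y, rfl⟩ := Submodule.Quotient.mk_surjective _ y
    refine (Submodule.Quotient.eq Q).2 ?_
    simpa [sub_mul] using Q.mul_mem_right y hdQ
  have hAB : (A ∪ B).ncard < (A ∪ B ∪ C).ncard :=
    Set.ncard_lt_ncard_of_mem (x := c) (by grind) (by grind) (by grind)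
  have hAC : (A ∪ C).ncard < (A ∪ B ∪ C).ncard :=
    Set.ncard_lt_ncard_of_mem (x := b) (by grind) (by grind) (by grind)
  have hBC : (B ∪ C).ncard < (A ∪ B ∪ C).ncard :=
    Set.ncard_lt_ncard_of_mem (x := a) (by grind) (by grind) (by grind)
  have hA : A.ncard < (A ∪ B).ncard :=
    Set.ncard_lt_ncard_of_mem (x := b) (by grind) (by grind) (by grind)
  have hB : B.ncard < (A ∪ B).ncard :=
    Set.ncard_lt_ncard_of_mem (x := a) (by grind) (by grind) (by grind)
  have hC : C.ncard < (A ∪ C).ncard :=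
    Set.ncard_lt_ncard_of_mem (x := a) (by grind) (by grind) (by grind)
  have h₁ := h.left (.of_smul_eq (r := X d) (Ideal.mem_sup_right (X_mem_varIdeal hd.1)) hdY)
  have h₂ := h₁.sup (extVanishes_varIdeal_inf _ (by lia) (by lia) (by lia))
    (extVanishes_varIdeal _ C (by lia))
  rw [varIdeal_inf_sup] at h₂
  have h₃ := h₂.sup (extVanishes_varIdeal _ _ (by lia)) (extVanishes_varIdeal _ _ (by lia))
  rw [← varIdeal_union, ← Set.union_union_distrib_right, add_assoc, one_add_one_eq_two, ← hk] at h₃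
  exact not_extVanishes_varIdeal hQ _ hABC h₃

lemma extVanishes_varIdeal_inf_inf_inf (Y : ModuleCat.{u} (MvPolynomial σ K))
    {a₁ a₂ a₃ b c : σ} (h₁ : a₁ ∈ A \ (B ∪ C)) (h₂ : a₂ ∈ A \ (B ∪ D))
    (h₃ : a₃ ∈ A \ (C ∪ D)) (hb : b ∈ B \ (A ∪ C ∪ D)) (hc : c ∈ C \ (A ∪ B ∪ D))
    (hA : A ⊆ B ∪ C ∪ D) {k : ℕ}
    (hABC : (A ∪ B ∪ C).ncard < k + 2) (hABD : (A ∪ B ∪ D).ncard < k + 2)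
    (hACD : (A ∪ C ∪ D).ncard < k + 2) :
    ExtVanishes (varIdeal K A ⊓ varIdeal K B ⊓ varIdeal K C ⊓ varIdeal K D) Y k := by
  have hAB : (A ∪ B).ncard < (A ∪ B ∪ C).ncard :=
    Set.ncard_lt_ncard_of_mem (x := c) (by grind) (by grind) (by grind)
  have hAC : (A ∪ C).ncard < (A ∪ B ∪ C).ncard :=
    Set.ncard_lt_ncard_of_mem (x := b) (by grind) (by grind) (by grind)
  have hBC : (B ∪ C).ncard < (A ∪ B ∪ C).ncard :=
    Set.ncard_lt_ncard_of_mem (x := a₁) (by grind) (by grind) (by grind)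
  have hAD : (A ∪ D).ncard < (A ∪ C ∪ D).ncard :=
    Set.ncard_lt_ncard_of_mem (x := c) (by grind) (by grind) (by grind)
  have hBD : (B ∪ D).ncard < (A ∪ B ∪ D).ncard :=
    Set.ncard_lt_ncard_of_mem (x := a₂) (by grind) (by grind) (by grind)
  have hCD : (C ∪ D).ncard < (A ∪ C ∪ D).ncard :=
    Set.ncard_lt_ncard_of_mem (x := a₃) (by grind) (by grind) (by grind)
  have hA' : A.ncard < (A ∪ B).ncard :=
    Set.ncard_lt_ncard_of_mem (x := b) (by grind) (by grind) (by grind)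
  have hB' : B.ncard < (A ∪ B).ncard :=
    Set.ncard_lt_ncard_of_mem (x := a₁) (by grind) (by grind) (by grind)
  have hC' : C.ncard < (A ∪ C).ncard :=
    Set.ncard_lt_ncard_of_mem (x := a₁) (by grind) (by grind) (by grind)
  have hD' : D.ncard < (A ∪ D).ncard :=
    Set.ncard_lt_ncard_of_mem (x := a₂) (by grind) (by grind) (by grind)
  refine .inf (.inf (extVanishes_varIdeal_inf Y (by lia) (by lia) (by lia))
    (extVanishes_varIdeal Y C (by lia)) ?_) (extVanishes_varIdeal Y D (by lia)) ?_
  · rw [varIdeal_inf_sup]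
    refine extVanishes_varIdeal_inf Y (by lia) (by lia) ?_
    rw [← Set.union_union_distrib_right]
    lia
  · rw [varIdeal_inf_inf_sup, inf_right_comm]
    refine .inf (extVanishes_varIdeal_inf Y (by lia) (by lia) ?_)
      (extVanishes_varIdeal Y _ (by lia)) ?_
    · rw [← Set.union_union_distrib_right]
      lia
    · have h : A ∪ D ∪ (B ∪ D) ⊆ C ∪ D ∪ (B ∪ D) := by grind
      rw [varIdeal_inf_sup, inf_eq_left.2 (varIdeal_mono h), ← Set.union_union_distrib_right]
      exact extVanishes_varIdeal Y _ (by lia)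

end VariableIdeals

lemma pdim_quotient_eq {R : Type u} [CommRing R] {I : Ideal R} {n : ℕ}
    (h : ∀ k, n < k → ∀ Y, ExtVanishes I Y k) (h' : ∃ Y, ¬ ExtVanishes I Y n) (hn : n ≠ 0) :
    pdim R (ModuleCat.of R (R ⧸ I)) = n := by
  refine le_antisymm (sInf_le fun k hk Y ↦ ?_) (le_sInf fun m hm ↦ ?_)
  · rw [Nat.cast_lt] at hk
    obtain ⟨k, rfl⟩ := Nat.exists_eq_succ_of_ne_zero (by lia : k ≠ 0)
    exact (subsingleton_ext_iff _ Y k).2 (h _ hk Y)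
  · obtain ⟨n, rfl⟩ := Nat.exists_eq_succ_of_ne_zero hn
    obtain ⟨Y, hY⟩ := h'
    by_contra! hlt
    exact hY ((subsingleton_ext_iff _ Y n).1 (hm _ hlt Y))

section Blocks

variable (i : Fin 6 → ℕ) (j : Fin 3 → ℕ)

/-- The variables in the `x`-blocks `xs` and the `y`-blocks `ys`. -/
def blockVars (xs : Set (Fin 6)) (ys : Set (Fin 3)) : Set (VarIdx i j) :=
  {v | Sum.elim (fun p => p.1 ∈ xs) (fun p => p.1 ∈ ys) v}

lemma blockPrime_eq_varIdeal (K : Type u) [Field K] (xs : Set (Fin 6)) (ys : Set (Fin 3)) :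
    blockPrime K i j xs ys = varIdeal K (blockVars i j xs ys) := rfl

variable {i j}

lemma inl_mem_blockVars {xs : Set (Fin 6)} {ys : Set (Fin 3)} {p : Σ s : Fin 6, Fin (i s)} :
    (.inl p : VarIdx i j) ∈ blockVars i j xs ys ↔ p.1 ∈ xs := Iff.rfl

lemma inr_mem_blockVars {xs : Set (Fin 6)} {ys : Set (Fin 3)} {p : Σ t : Fin 3, Fin (j t)} :
    (.inr p : VarIdx i j) ∈ blockVars i j xs ys ↔ p.1 ∈ ys := Iff.rfl

lemma blockVars_union (xs xs' : Set (Fin 6)) (ys ys' : Set (Fin 3)) :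
    blockVars i j xs ys ∪ blockVars i j xs' ys' = blockVars i j (xs ∪ xs') (ys ∪ ys') := by
  ext (p | p) <;> rfl

lemma blockVars_univ_compl_singleton_ncard (t : Fin 3) :
    (blockVars i j Set.univ {t}ᶜ).ncard = (∑ s, i s) + (∑ t, j t) - j t := by
  have h : (blockVars i j Set.univ {t}ᶜ)ᶜ =
      Set.range fun x : Fin (j t) ↦ (.inr ⟨t, x⟩ : VarIdx i j) := by
    ext (p | ⟨t', x⟩)
    · simp [inl_mem_blockVars]
    · simp only [Set.mem_compl_iff, inr_mem_blockVars, Set.mem_singleton_iff, not_not,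
        Set.mem_range, Sum.inr.injEq]
      constructor
      · rintro rfl
        exact ⟨x, rfl⟩
      · rintro ⟨y, hy⟩
        exact (congrArg Sigma.fst hy).symm
  have hinj : Function.Injective fun x : Fin (j t) ↦ (.inr ⟨t, x⟩ : VarIdx i j) :=
    Sum.inr_injective.comp sigma_mk_injective
  have h₁ := Set.ncard_add_ncard_compl (blockVars i j Set.univ {t}ᶜ)
  rw [h, ← Set.image_univ, Set.ncard_image_of_injective _ hinj] at h₁
  simp only [Set.ncard_univ, Nat.card_eq_fintype_card, Fintype.card_sum, Fintype.card_sigma,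
    Fintype.card_fin] at h₁
  lia

end Blocks

theorem pdim_of_intersection_of_four_block_primes
    (K : Type u) [Field K] (i : Fin 6 → ℕ) (j : Fin 3 → ℕ)
    (hi : ∀ s, 1 ≤ i s) (hj : ∀ t, 1 ≤ j t)
    (P₁ P₂ P₃ P₄ I : Ideal (MvPolynomial (VarIdx i j) K))
    (hP₁ : P₁ = blockPrime K i j {0, 3, 4} ∅)
    (hP₂ : P₂ = blockPrime K i j {0, 1, 5} {0})
    (hP₃ : P₃ = blockPrime K i j {1, 2, 4} {1})
    (hP₄ : P₄ = blockPrime K i j {2, 3, 5} {2})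
    (hI : I = P₁ ⊓ P₂ ⊓ P₃ ⊓ P₄)
    (N : ℕ) (hN : N = (∑ s, i s) + (∑ t, j t)) :
    pdim (MvPolynomial (VarIdx i j) K)
        (ModuleCat.of (MvPolynomial (VarIdx i j) K)
          (MvPolynomial (VarIdx i j) K ⧸ I))
      = ((max (max (N - j 0 - 2) (N - j 1 - 2)) (N - j 2 - 2) : ℕ) : ℕ∞) := by
  let x (s : Fin 6) : VarIdx i j := .inl ⟨s, ⟨0, hi s⟩⟩
  let y (t : Fin 3) : VarIdx i j := .inr ⟨t, ⟨0, hj t⟩⟩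
  have hx (s xs ys) : x s ∈ blockVars i j xs ys ↔ s ∈ xs := Iff.rfl
  have hy (t xs ys) : y t ∈ blockVars i j xs ys ↔ t ∈ ys := Iff.rfl
  rw [blockPrime_eq_varIdeal] at hP₁ hP₂ hP₃ hP₄
  set A := blockVars i j {0, 3, 4} ∅ with hA
  set B := blockVars i j {0, 1, 5} {0} with hB
  set C := blockVars i j {1, 2, 4} {1} with hC
  set D := blockVars i j {2, 3, 5} {2} with hD
  subst hP₁ hP₂ hP₃ hP₄ hI
  have hABC : (A ∪ B ∪ C).ncard = N - j 2 := by
    rw [hN, ← blockVars_univ_compl_singleton_ncard, hA, hB, hC]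
    simp only [blockVars_union]
    congr 2 <;> (ext s; fin_cases s <;> simp)
  have hABD : (A ∪ B ∪ D).ncard = N - j 1 := by
    rw [hN, ← blockVars_univ_compl_singleton_ncard, hA, hB, hD]
    simp only [blockVars_union]
    congr 2 <;> (ext s; fin_cases s <;> simp)
  have hACD : (A ∪ C ∪ D).ncard = N - j 0 := by
    rw [hN, ← blockVars_univ_compl_singleton_ncard, hA, hC, hD]
    simp only [blockVars_union]
    congr 2 <;> (ext s; fin_cases s <;> simp)
  have hAs : A ⊆ B ∪ C ∪ D := by
    rintro (p | p) hp
    · simp only [hA, hB, hC, hD, blockVars_union, inl_mem_blockVars] at hp ⊢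
      grind
    · exact hp.elim
  have hN' : 6 ≤ ∑ s, i s := by
    simpa using Finset.sum_le_sum fun s (_ : s ∈ Finset.univ) ↦ hi s
  have hj' : ∑ t, j t = j 0 + j 1 + j 2 := Fin.sum_univ_three j
  have hwit : x 3 ∈ A \ (B ∪ C) ∧ x 4 ∈ A \ (B ∪ D) ∧ x 0 ∈ A \ (C ∪ D) ∧
      y 0 ∈ B \ (A ∪ C ∪ D) ∧ y 1 ∈ C \ (A ∪ B ∪ D) ∧ y 2 ∈ D \ (A ∪ B ∪ C) := by
    simp [A, B, C, D, hx, hy]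
  obtain ⟨h₁, h₂, h₃, hb, hc, hd⟩ := hwit
  refine pdim_quotient_eq (fun k hk Y ↦ extVanishes_varIdeal_inf_inf_inf Y h₁ h₂ h₃ hb hc hAs
    (by lia) (by lia) (by lia)) ?_ (by lia)
  rcases max_choice (max (N - j 0 - 2) (N - j 1 - 2)) (N - j 2 - 2) with h | h
  · rcases max_choice (N - j 0 - 2) (N - j 1 - 2) with h' | h'
    · rw [h, h', inf_right_comm (varIdeal K A), inf_right_comm (varIdeal K A ⊓ varIdeal K C),
        ← hACD]
      exact exists_not_extVanishes_varIdeal_inf (a := x 0) (b := y 1) (c := y 2) (d := y 0)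
        (by grind) (by grind) (by grind) (by grind) (by lia)
    · rw [h, h', inf_right_comm (varIdeal K A ⊓ varIdeal K B), ← hABD]
      exact exists_not_extVanishes_varIdeal_inf (a := x 4) (b := y 0) (c := y 2) (d := y 1)
        (by grind) (by grind) (by grind) (by grind) (by lia)
  · rw [h, ← hABC]
    exact exists_not_extVanishes_varIdeal_inf (a := x 3) (b := y 0) (c := y 1) (d := y 2)
        (by grind) (by grind) (by grind) (by grind) (by lia)
end
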